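/- arXiv:2411.16605 — 9 statements merged into one kernel-verified Lean document; each statement's English description precedes it below -/
import Mathlib

section
/- Let h : ℝⁿ → ℂ be continuously differentiable and satisfy the linear PDE Dh(x)[f(x)] − λ h(x) + wᵀ f_n(x) = 0 for all x ∈ ℝⁿ. Then for every x and every t in an interval J ∋ 0 on which the trajectory t ↦ s_t(x) is defined, the scalar function t ↦ e^{−λt} h(s_t(x)) is differentiable with derivative −e^{−λt} wᵀ f_n(s_t(x)). -/
open MeasureTheory

/-- Bilinear (non-conjugated) pairing `wᵀ y` of `w ∈ ℂⁿ` with `y ∈ ℝⁿ ⊆ ℂⁿ`. -/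
noncomputable def pairing {n : ℕ} (w : Fin n → ℂ) (y : EuclideanSpace ℝ (Fin n)) : ℂ :=
  ∑ i, w i * (y i : ℂ)

/-- The purely nonlinear part `f_n(x) = f(x) − A x` where `A = Df(0)`. -/
noncomputable def nonlinearPart {n : ℕ}
    (f : EuclideanSpace ℝ (Fin n) → EuclideanSpace ℝ (Fin n))
    (x : EuclideanSpace ℝ (Fin n)) : EuclideanSpace ℝ (Fin n) :=
  f x - fderiv ℝ f 0 x

theorem stmt_0 {n : ℕ}
    (f : EuclideanSpace ℝ (Fin n) → EuclideanSpace ℝ (Fin n))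
    (hf : ContDiff ℝ 1 f) (hf0 : f 0 = 0)
    (lam : ℂ) (w : Fin n → ℂ)
    (h : EuclideanSpace ℝ (Fin n) → ℂ) (hh : ContDiff ℝ 1 h)
    (hpde : ∀ x, fderiv ℝ h x (f x) - lam * h x + pairing w (nonlinearPart f x) = 0)
    (x : EuclideanSpace ℝ (Fin n))
    (J : Set ℝ) (hJ : J.OrdConnected) (h0J : (0 : ℝ) ∈ J)
    (s : ℝ → EuclideanSpace ℝ (Fin n)) (hs0 : s 0 = x)
    (hs : ∀ t ∈ J, HasDerivAt s (f (s t)) t) :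
    ∀ t ∈ J,
      HasDerivAt (fun τ : ℝ => Complex.exp (-lam * τ) * h (s τ))
        (-(Complex.exp (-lam * t)) * pairing w (nonlinearPart f (s t))) t := by
  intro t ht
  have h1 : HasDerivAt (fun τ : ℝ => h (s τ)) (fderiv ℝ h (s t) (f (s t))) t :=
    ((hh.differentiable (by norm_num)) (s t)).hasFDerivAt.comp_hasDerivAt t (hs t ht)
  have h2 : HasDerivAt (fun τ : ℝ => Complex.exp (-lam * τ))
      (Complex.exp (-lam * t) * (-lam * 1)) t :=
    ((Complex.ofRealCLM.hasDerivAt (x := t)).const_mul (-lam)).cexp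
  refine (h2.mul h1).congr_deriv ?_
  linear_combination (Complex.exp (-lam * t)) * hpde (s t)
end

section
/- (Path-integral formula, Theorem 1.) Let h : ℝⁿ → ℂ be continuously differentiable and satisfy Dh(x)[f(x)] − λ h(x) + wᵀ f_n(x) = 0 for all x ∈ ℝⁿ. Then for every x and every t in an interval J ∋ 0 on which the trajectory t ↦ s_t(x) is defined, h(x) = e^{−λt} h(s_t(x)) + ∫₀ᵗ e^{−λτ} wᵀ f_n(s_τ(x)) dτ. -/
open MeasureTheory

/-- Path-integral formula (Theorem 1):
`h(x) = e^{−λt} h(s_t(x)) + ∫₀ᵗ e^{−λτ} wᵀ f_n(s_τ(x)) dτ`. -/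
theorem stmt_1 {n : ℕ}
    (f : EuclideanSpace ℝ (Fin n) → EuclideanSpace ℝ (Fin n))
    (hf : ContDiff ℝ 1 f) (hf0 : f 0 = 0)
    (lam : ℂ) (w : Fin n → ℂ)
    (h : EuclideanSpace ℝ (Fin n) → ℂ) (hh : ContDiff ℝ 1 h)
    (hpde : ∀ x, fderiv ℝ h x (f x) - lam * h x + pairing w (nonlinearPart f x) = 0)
    (x : EuclideanSpace ℝ (Fin n))
    (J : Set ℝ) (hJ : J.OrdConnected) (h0J : (0 : ℝ) ∈ J)
    (s : ℝ → EuclideanSpace ℝ (Fin n)) (hs0 : s 0 = x)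
    (hs : ∀ t ∈ J, HasDerivAt s (f (s t)) t) :
    ∀ t ∈ J,
      h x = Complex.exp (-lam * t) * h (s t)
          + ∫ τ in (0 : ℝ)..t, Complex.exp (-lam * τ) * pairing w (nonlinearPart f (s τ)) := by
  intro t ht
  have hsub : Set.uIcc 0 t ⊆ J := hJ.uIcc_subset h0J ht
  have hpair : Continuous fun y => pairing w (nonlinearPart f y) := by
    have hc := hf.continuous
    unfold pairing nonlinearPart
    fun_prop
  have hsc : ContinuousOn s (Set.uIcc 0 t) := fun u hu =>
    (hs u (hsub hu)).continuousAt.continuousWithinAt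
  have hder : ∀ u ∈ Set.uIcc 0 t, HasDerivAt (fun τ : ℝ => -(Complex.exp (-lam * τ) * h (s τ)))
      (Complex.exp (-lam * u) * pairing w (nonlinearPart f (s u))) u := by
    intro u hu
    have h1 : HasDerivAt (fun τ : ℝ => h (s τ)) (fderiv ℝ h (s u) (f (s u))) u :=
      ((hh.differentiable (by norm_num)) (s u)).hasFDerivAt.comp_hasDerivAt u (hs u (hsub hu))
    have h2 : HasDerivAt (fun τ : ℝ => Complex.exp (-lam * τ))
        (Complex.exp (-lam * u) * (-lam * 1)) u :=
      ((Complex.ofRealCLM.hasDerivAt (x := u)).const_mul (-lam)).cexp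
    refine (h2.mul h1).neg.congr_deriv ?_
    linear_combination (-Complex.exp (-lam * u)) * hpde (s u)
  have hint : IntervalIntegrable
      (fun τ : ℝ => Complex.exp (-lam * τ) * pairing w (nonlinearPart f (s τ))) volume 0 t := by
    apply ContinuousOn.intervalIntegrable
    apply ContinuousOn.mul
    · fun_prop
    · exact hpair.comp_continuousOn hsc
  rw [intervalIntegral.integral_eq_sub_of_hasDerivAt hder hint]
  simp [hs0]
end

section
/- (Eigenfunctions of stable systems via path integrals, Theorem 3, semigroup form.) Fix x ∈ ℝⁿ and suppose the flow s is defined for all t ≥ 0 at all points of the trajectory of x and satisfies the semigroup property s_{t+τ}(x) = s_τ(s_t(x)) for t, τ ≥ 0. Let w ∈ ℂⁿ satisfy wᵀ A = λ wᵀ for λ ∈ ℂ, and suppose there are constants M, K ≥ 0 and μ ∈ ℝ with −Re(λ) + 2μ < 0 such that ‖s_{t}(x)‖ ≤ M e^{μt} for all t ≥ 0 and ‖f_n(y)‖ ≤ K ‖y‖² for all y ∈ ℝⁿ. Then for every point y on the trajectory of x the improper integral ∫₀^∞ e^{−λt} wᵀ f_n(s_t(y)) dt converges absolutely, and the function φ(y)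 := wᵀ y + ∫₀^∞ e^{−λt} wᵀ f_n(s_t(y)) dt satisfies the Koopman eigenfunction property φ(s_t(x)) = e^{λt} φ(x) for all t ≥ 0. -/
open MeasureTheory

noncomputable def pairL {n : ℕ} (w : Fin n → ℂ) : EuclideanSpace ℝ (Fin n) →L[ℝ] ℂ :=
  LinearMap.toContinuousLinearMap
    { toFun := pairing w
      map_add' := by
        intro a b
        simp [pairing, mul_add, Finset.sum_add_distrib]
      map_smul' := by
        intro c a
        simp only [pairing, Finset.smul_sum, PiLp.smul_apply, smul_eq_mul, Complex.ofReal_mul,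
          RingHom.id_apply, Complex.real_smul]
        exact Finset.sum_congr rfl fun i _ => by ring }

theorem pairL_apply {n : ℕ} (w : Fin n → ℂ) (y : EuclideanSpace ℝ (Fin n)) :
    pairL w y = pairing w y := rfl

/-- Eigenfunctions of stable systems via path integrals (Theorem 3, semigroup form):
for every point `y = Φ t₀ x` on the trajectory of `x` the improper integral
`∫₀^∞ e^{−λt} wᵀ f_n(s_t(y)) dt` converges absolutely, and
`φ(y) := wᵀy + ∫₀^∞ e^{−λt} wᵀ f_n(s_t(y)) dt` satisfies `φ(s_t(x)) = e^{λt} φ(x)`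
for all `t ≥ 0`. -/
theorem stmt_5 {n : ℕ}
    (f : EuclideanSpace ℝ (Fin n) → EuclideanSpace ℝ (Fin n))
    (hf : ContDiff ℝ 1 f) (hf0 : f 0 = 0)
    (Φ : ℝ → EuclideanSpace ℝ (Fin n) → EuclideanSpace ℝ (Fin n))
    (x : EuclideanSpace ℝ (Fin n))
    (hΦ0 : ∀ y, Φ 0 y = y)
    (hΦderiv : ∀ t₀ : ℝ, 0 ≤ t₀ → ∀ t : ℝ, 0 ≤ t →
      HasDerivAt (fun τ => Φ τ (Φ t₀ x)) (f (Φ t (Φ t₀ x))) t)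
    (hsemi : ∀ t : ℝ, 0 ≤ t → ∀ τ : ℝ, 0 ≤ τ → Φ (t + τ) x = Φ τ (Φ t x))
    (lam : ℂ) (w : Fin n → ℂ)
    (hw : ∀ y, pairing w (fderiv ℝ f 0 y) = lam * pairing w y)
    (M K : ℝ) (hM : 0 ≤ M) (hK : 0 ≤ K)
    (μ : ℝ) (hspec : -lam.re + 2 * μ < 0)
    (hgrow : ∀ t : ℝ, 0 ≤ t → ‖Φ t x‖ ≤ M * Real.exp (μ * t))
    (hfn : ∀ y, ‖nonlinearPart f y‖ ≤ K * ‖y‖ ^ 2) :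
    (∀ t₀ : ℝ, 0 ≤ t₀ →
      IntegrableOn
        (fun t : ℝ => Complex.exp (-lam * t) * pairing w (nonlinearPart f (Φ t (Φ t₀ x))))
        (Set.Ici (0 : ℝ))) ∧
    (∀ t : ℝ, 0 ≤ t →
      (pairing w (Φ t x)
          + ∫ τ in Set.Ici (0 : ℝ),
              Complex.exp (-lam * τ) * pairing w (nonlinearPart f (Φ τ (Φ t x))))
        = Complex.exp (lam * t) *
          (pairing w x
            + ∫ τ in Set.Ici (0 : ℝ),
                Complex.exp (-lam * τ) * pairing w (nonlinearPart f (Φ τ x)))) := by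
  have hfd : Continuous (nonlinearPart f) := by
    unfold nonlinearPart
    exact hf.continuous.sub (fderiv ℝ f 0).continuous
  have hint : ∀ t₀ : ℝ, 0 ≤ t₀ →
      IntegrableOn
        (fun t : ℝ => Complex.exp (-lam * t) * pairing w (nonlinearPart f (Φ t (Φ t₀ x))))
        (Set.Ici (0 : ℝ)) := by
    intro t₀ ht₀
    have hdom : IntegrableOn (fun t : ℝ => (‖pairL w‖ * (K * (M * Real.exp (μ * t₀)) ^ 2)) *
        Real.exp (-(lam.re - 2 * μ) * t)) (Set.Ici (0 : ℝ)) := by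
      rw [integrableOn_Ici_iff_integrableOn_Ioi]
      exact (exp_neg_integrableOn_Ioi 0 (by linarith)).const_mul _
    refine Integrable.mono' hdom ?_ ?_
    · refine ContinuousOn.aestronglyMeasurable ?_ measurableSet_Ici
      refine ContinuousOn.mul (by fun_prop) ?_
      have h1 : ContinuousOn (fun t => Φ t (Φ t₀ x)) (Set.Ici (0 : ℝ)) := fun t ht =>
        (hΦderiv t₀ ht₀ t ht).continuousAt.continuousWithinAt
      exact (pairL w).continuous.comp_continuousOn (hfd.comp_continuousOn h1)
    · refine (ae_restrict_iff' measurableSet_Ici).2 (Filter.Eventually.of_forall fun t ht => ?_)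
      have ht : 0 ≤ t := ht
      have hb := hgrow (t₀ + t) (by positivity)
      rw [hsemi t₀ ht₀ t ht] at hb
      rw [norm_mul, Complex.norm_exp, ← pairL_apply]
      have h2 : ‖pairL w (nonlinearPart f (Φ t (Φ t₀ x)))‖ ≤
          ‖pairL w‖ * (K * (M * Real.exp (μ * (t₀ + t))) ^ 2) := by
        refine ((pairL w).le_opNorm _).trans ?_
        gcongr
        refine (hfn _).trans ?_
        gcongr
      have h3 : (-lam * (t : ℂ)).re = -lam.re * t := by simp
      rw [h3]
      calc _ ≤ Real.exp (-lam.re * t) * (‖pairL w‖ * (K * (M * Real.exp (μ * (t₀ + t))) ^ 2)) := by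
            gcongr
        _ = _ := by
            have e1 : Real.exp (μ * (t₀ + t)) = Real.exp (μ * t₀) * Real.exp (μ * t) := by
              rw [← Real.exp_add]; ring_nf
            have e2 : Real.exp (-(lam.re - 2 * μ) * t)
                = Real.exp (-lam.re * t) * (Real.exp (μ * t) * Real.exp (μ * t)) := by
              rw [← Real.exp_add, ← Real.exp_add]; ring_nf
            rw [e1, e2]; ring
  refine ⟨hint, fun t ht => ?_⟩
  set g : ℝ → ℂ := fun τ => Complex.exp (-lam * τ) * pairing w (nonlinearPart f (Φ τ x)) with hg
  have hgint : IntegrableOn g (Set.Ici 0) := by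
    have := hint 0 le_rfl
    rwa [hΦ0 x] at this
  have hder : ∀ s : ℝ, 0 ≤ s →
      HasDerivAt (fun τ : ℝ => Complex.exp (-lam * τ) * pairing w (Φ τ x)) (g s) s := by
    intro s hs
    have h1 := hΦderiv 0 le_rfl s hs
    rw [hΦ0 x] at h1
    have h2 : HasDerivAt (fun τ : ℝ => pairing w (Φ τ x)) (pairing w (f (Φ s x))) s :=
      (pairL w).hasFDerivAt.comp_hasDerivAt s h1
    have h3 : HasDerivAt (fun τ : ℝ => Complex.exp (-lam * τ))
        (Complex.exp (-lam * s) * (-lam * 1)) s :=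
      ((Complex.ofRealCLM.hasDerivAt (x := s)).const_mul (-lam)).cexp
    refine (h3.mul h2).congr_deriv ?_
    have h4 : pairing w (nonlinearPart f (Φ s x))
        = pairing w (f (Φ s x)) - lam * pairing w (Φ s x) := by
      rw [← hw]
      exact map_sub (pairL w) _ _
    change _ = Complex.exp (-lam * s) * pairing w (nonlinearPart f (Φ s x))
    rw [h4]
    ring
  have hftc : ∫ τ in (0 : ℝ)..t, g τ
      = Complex.exp (-lam * t) * pairing w (Φ t x) - pairing w x := by
    rw [intervalIntegral.integral_eq_sub_of_hasDerivAt
      (f := fun τ : ℝ => Complex.exp (-lam * τ) * pairing w (Φ τ x))]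
    · simp [hΦ0]
    · intro s hs
      rw [Set.uIcc_of_le ht] at hs
      exact hder s hs.1
    · rw [intervalIntegrable_iff_integrableOn_Icc_of_le ht]
      exact hgint.mono_set Set.Icc_subset_Ici_self
  have hshift : ∫ τ in Set.Ici (0 : ℝ),
      Complex.exp (-lam * τ) * pairing w (nonlinearPart f (Φ τ (Φ t x)))
      = Complex.exp (lam * t) * ∫ τ in Set.Ioi t, g τ := by
    have e : ∫ τ in Set.Ioi t, g τ = ∫ τ in Set.Ioi (0 : ℝ), g (τ + t) := by
      have := (measurePreserving_add_right volume t).setIntegral_preimage_emb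
        (measurableEmbedding_addRight t) g (Set.Ioi t)
      simpa using this.symm
    rw [e, integral_Ici_eq_integral_Ioi, ← integral_const_mul]
    refine setIntegral_congr_fun measurableSet_Ioi fun τ hτ => ?_
    have hτ : 0 < τ := hτ
    simp only [hg]
    rw [add_comm τ t, hsemi t ht τ hτ.le, ← mul_assoc, ← Complex.exp_add]
    congr 2
    push_cast
    ring
  have hsplit : ∫ τ in Set.Ici (0 : ℝ), g τ
      = (∫ τ in (0 : ℝ)..t, g τ) + ∫ τ in Set.Ioi t, g τ := by
    rw [integral_Ici_eq_integral_Ioi, intervalIntegral.integral_of_le ht,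
      ← setIntegral_union (Set.Ioc_disjoint_Ioi le_rfl) measurableSet_Ioi
        (hgint.mono_set (Set.Ioc_subset_Icc_self.trans Set.Icc_subset_Ici_self))
        (hgint.mono_set fun s hs => ht.trans (le_of_lt hs)), Set.Ioc_union_Ioi_eq_Ioi ht]
  rw [hshift, hsplit, hftc]
  have he : Complex.exp (lam * t) * Complex.exp (-lam * t) = 1 := by
    rw [← Complex.exp_add]; simp
  linear_combination (-pairing w (Φ t x)) * he
end

section
/- (Finite-time path-integral with approximate boundary data, Theorem 4.) Let S ⊂ ℝⁿ and let x ∈ ℝⁿ be a point for which there exists t̄ ∈ ℝ such that the trajectory τ ↦ s_τ(x) is defined on the closed interval between 0 and t̄ and s_{t̄}(x) ∈ S. Suppose h : ℝⁿ → ℂ is continuously differentiable and satisfies Dh(y)[f(y)] − λ h(y) + wᵀ f_n(y) = 0 for all y, and ĥ : ℝⁿ → ℂ satisfies |h(y) − ĥ(y)| ≤ ε for all y ∈ S. Define h̃(x) := e^{−λ t̄} ĥ(s_{t̄}(x)) + ∫₀^{t̄} e^{−λτ} wᵀ f_n(s_τ(x)) dτ. Then |h̃(x) − h(x)| ≤ ε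 · e^{−Re(λ) t̄}. -/
/-- Finite-time path-integral with approximate boundary data (Theorem 4):
if `|h − ĥ| ≤ ε` on `S` and `s_{t̄}(x) ∈ S`, then the finite-time path-integral estimate
`h̃(x) = e^{−λt̄} ĥ(s_{t̄}(x)) + ∫₀^{t̄} e^{−λτ} wᵀ f_n(s_τ(x)) dτ` satisfies
`|h̃(x) − h(x)| ≤ ε e^{−Re(λ) t̄}`. -/
theorem stmt_7 {n : ℕ}
    (f : EuclideanSpace ℝ (Fin n) → EuclideanSpace ℝ (Fin n))
    (hf : ContDiff ℝ 1 f) (hf0 : f 0 = 0)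
    (lam : ℂ) (w : Fin n → ℂ)
    (h : EuclideanSpace ℝ (Fin n) → ℂ) (hh : ContDiff ℝ 1 h)
    (hpde : ∀ y, fderiv ℝ h y (f y) - lam * h y + pairing w (nonlinearPart f y) = 0)
    (S : Set (EuclideanSpace ℝ (Fin n)))
    (hhat : EuclideanSpace ℝ (Fin n) → ℂ) (ε : ℝ) (hε : 0 ≤ ε)
    (hest : ∀ y ∈ S, ‖h y - hhat y‖ ≤ ε)
    (x : EuclideanSpace ℝ (Fin n)) (tbar : ℝ)
    (s : ℝ → EuclideanSpace ℝ (Fin n)) (hs0 : s 0 = x)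
    (hs : ∀ t ∈ Set.uIcc (0 : ℝ) tbar, HasDerivAt s (f (s t)) t)
    (hS : s tbar ∈ S) :
    ‖(Complex.exp (-lam * tbar) * hhat (s tbar)
        + ∫ τ in (0 : ℝ)..tbar, Complex.exp (-lam * τ) * pairing w (nonlinearPart f (s τ)))
      - h x‖ ≤ ε * Real.exp (-lam.re * tbar) := by
  have hpc : Continuous (fun y => pairing w (nonlinearPart f y)) := by
    have hfc := hf.continuous
    have h1 : Continuous (nonlinearPart f) := by
      unfold nonlinearPart
      exact hfc.sub (fderiv ℝ f 0).continuous
    unfold pairing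
    refine continuous_finsetSum _ fun i _ => continuous_const.mul ?_
    exact Complex.continuous_ofReal.comp ((EuclideanSpace.proj (𝕜 := ℝ) i).continuous.comp h1)
  have hsc : ContinuousOn s (Set.uIcc 0 tbar) :=
    fun t ht => (hs t ht).continuousAt.continuousWithinAt
  have hec : Continuous (fun t : ℝ => Complex.exp (-lam * t)) := by fun_prop
  have hd : ∀ t ∈ Set.uIcc (0 : ℝ) tbar,
      HasDerivAt (fun t : ℝ => -(Complex.exp (-lam * t) * h (s t)))
        (Complex.exp (-lam * t) * pairing w (nonlinearPart f (s t))) t := by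
    intro t ht
    have h1 : HasDerivAt (fun t => h (s t)) (fderiv ℝ h (s t) (f (s t))) t :=
      ((hh.differentiable (by norm_num)) (s t)).hasFDerivAt.comp_hasDerivAt t (hs t ht)
    have h2 : HasDerivAt (fun t : ℝ => Complex.exp (-lam * t))
        (Complex.exp (-lam * t) * (-lam * 1)) t :=
      ((Complex.ofRealCLM.hasDerivAt (x := t)).const_mul (-lam)).cexp
    refine (h2.mul h1).neg.congr_deriv ?_
    linear_combination -Complex.exp (-lam * t) * hpde (s t)
  have hint := intervalIntegral.integral_eq_sub_of_hasDerivAt hd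
    ((hec.continuousOn.mul (hpc.comp_continuousOn hsc)).intervalIntegrable)
  rw [hint, hs0]
  have e : Complex.exp (-lam * tbar) * hhat (s tbar) +
      (-(Complex.exp (-lam * tbar) * h (s tbar)) - -(Complex.exp (-lam * (0 : ℝ)) * h x)) - h x
      = -((h (s tbar) - hhat (s tbar)) * Complex.exp (-lam * tbar)) := by
    simp only [Complex.ofReal_zero, mul_zero, Complex.exp_zero]
    ring
  rw [e, norm_neg, norm_mul, Complex.norm_exp]
  have e2 : (-lam * (tbar : ℂ)).re = -lam.re * tbar := by simp
  rw [e2]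
  exact mul_le_mul_of_nonneg_right (hest _ hS) (Real.exp_pos _).le
end

section
/- (Key inequality in Proposition 1.) Let φ : ℝⁿ → ℂ be continuously differentiable with Dφ(x)[f(x)] = λ φ(x) for all x, let a, r > 0, and let 0 < ε₂ < r. Set β := sup_{‖y‖ ≤ r − ε₂} |Dφ(y)[f_n(y)]| (finite by continuity and compactness). Then for every x with ‖x‖ ≤ r − ε₂, |Dφ(x)[f̃(x)] − λ φ(x)| ≤ (1/2)(1 − tanh(a ε₂)) · β. -/
/-- The transformed vector field `f̃(x) = f(x) + σ(‖x‖ − r)(A x − f(x))`, where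
`σ(z) = (1 + tanh(a z))/2` and `A = Df(0)`. -/
noncomputable def ftilde {n : ℕ}
    (f : EuclideanSpace ℝ (Fin n) → EuclideanSpace ℝ (Fin n)) (a r : ℝ)
    (x : EuclideanSpace ℝ (Fin n)) : EuclideanSpace ℝ (Fin n) :=
  f x + ((1 + Real.tanh (a * (‖x‖ - r))) / 2) • (fderiv ℝ f 0 x - f x)

/-- Key inequality in Proposition 1: for `‖x‖ ≤ r − ε₂`,
`|Dφ(x)[f̃(x)] − λ φ(x)| ≤ (1/2)(1 − tanh(a ε₂)) β` with
`β = sup_{‖y‖ ≤ r−ε₂} |Dφ(y)[f_n(y)]|`. -/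
theorem stmt_8 {n : ℕ}
    (f : EuclideanSpace ℝ (Fin n) → EuclideanSpace ℝ (Fin n))
    (hf : ContDiff ℝ 1 f) (hf0 : f 0 = 0)
    (lam : ℂ) (φ : EuclideanSpace ℝ (Fin n) → ℂ) (hφ : ContDiff ℝ 1 φ)
    (hpde : ∀ x, fderiv ℝ φ x (f x) = lam * φ x)
    (a r ε₂ : ℝ) (ha : 0 < a) (hr : 0 < r) (hε₂ : 0 < ε₂) (hε₂r : ε₂ < r) :
    ∀ x : EuclideanSpace ℝ (Fin n), ‖x‖ ≤ r - ε₂ →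
      ‖fderiv ℝ φ x (ftilde f a r x) - lam * φ x‖
        ≤ (1 / 2) * (1 - Real.tanh (a * ε₂)) *
            sSup ((fun y => ‖fderiv ℝ φ y (nonlinearPart f y)‖) ''
              {y : EuclideanSpace ℝ (Fin n) | ‖y‖ ≤ r - ε₂}) := by
  intro x hx
  have hle : Real.tanh (a * (‖x‖ - r)) ≤ - Real.tanh (a * ε₂) := by
    rw [← Real.tanh_neg]
    have hmono : ∀ u v : ℝ, u ≤ v → Real.tanh u ≤ Real.tanh v := by
      intro u v huv
      rw [Real.tanh_eq_sinh_div_cosh, Real.tanh_eq_sinh_div_cosh,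
        div_le_div_iff₀ (Real.cosh_pos u) (Real.cosh_pos v)]
      have h := Real.sinh_nonneg_iff.2 (sub_nonneg.2 huv)
      rw [Real.sinh_sub] at h
      linarith
    exact hmono _ _ (by nlinarith)
  have hnn : 0 ≤ (1 + Real.tanh (a * (‖x‖ - r))) / 2 := by
    have := Real.neg_one_lt_tanh (a * (‖x‖ - r))
    linarith
  have hcont : Continuous (fun y => ‖fderiv ℝ φ y (nonlinearPart f y)‖) := by
    have h1 := hφ.continuous_fderiv one_ne_zero
    have h2 : Continuous (nonlinearPart f) :=
      hf.continuous.sub (fderiv ℝ f 0).continuous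
    exact (h1.clm_apply h2).norm
  have hcomp : IsCompact {y : EuclideanSpace ℝ (Fin n) | ‖y‖ ≤ r - ε₂} := by
    have h := isCompact_closedBall (0 : EuclideanSpace ℝ (Fin n)) (r - ε₂)
    have e : Metric.closedBall (0 : EuclideanSpace ℝ (Fin n)) (r - ε₂) = {y | ‖y‖ ≤ r - ε₂} := by
      ext y; simp
    rwa [e] at h
  have hsup := le_csSup (hcomp.image hcont).bddAbove (Set.mem_image_of_mem _ hx)
  have heq : fderiv ℝ φ x (ftilde f a r x) - lam * φ x
      = -(((1 + Real.tanh (a * (‖x‖ - r))) / 2) • fderiv ℝ φ x (nonlinearPart f x)) := by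
    rw [← hpde x, ftilde, nonlinearPart, map_add, map_smul, add_sub_cancel_left, ← smul_neg,
      ← map_neg, neg_sub]
  rw [heq, norm_neg, norm_smul, Real.norm_of_nonneg hnn]
  exact mul_le_mul (by linarith) hsup (norm_nonneg _) (by linarith)
end

section
/- (Proposition 1.) Let φ : ℝⁿ → ℂ be continuously differentiable with Dφ(x)[f(x)] = λ φ(x) for all x, and let r > 0. Then for any positive constants ε₁ and ε₂ < r, there exists a₀ > 0 such that for every a ≥ a₀ the transformed vector field f̃ (built with this a) satisfies |Dφ(x)[f̃(x)] − λ φ(x)| ≤ ε₁ whenever ‖x‖ ≤ r − ε₂; in particular, any a > (1/ε₂) · artanh(1 − 2ε₁/β) works when β := sup_{‖y‖ ≤ r − ε₂} |Dφ(y)[f_n(y)]| satisfies β > 2ε₁. -/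
/-- The inverse hyperbolic tangent, `artanh z = (1/2) log((1+z)/(1−z))`. -/
noncomputable def artanh (z : ℝ) : ℝ := Real.log ((1 + z) / (1 - z)) / 2

theorem sig_identity (z : ℝ) :
    (1 + Real.tanh z) / 2 = 1 / (1 + Real.exp (-(2 * z))) := by
  have h1 : Real.exp (-(2 * z)) = Real.exp (-z) * Real.exp (-z) := by
    rw [← Real.exp_add]; congr 1; ring
  have h2 : Real.exp z * Real.exp (-z) = 1 := by rw [← Real.exp_add]; simp
  have hp := Real.exp_pos z
  have hq := Real.exp_pos (-z)
  rw [Real.tanh_eq_sinh_div_cosh, Real.sinh_eq, Real.cosh_eq, h1]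
  have h3 : Real.exp z + Real.exp (-z) ≠ 0 := by positivity
  have h4 : 1 + Real.exp (-z) * Real.exp (-z) ≠ 0 := by positivity
  field_simp
  linear_combination (2 * Real.exp (-z)) * h2

theorem core_bound {n : ℕ}
    (f : EuclideanSpace ℝ (Fin n) → EuclideanSpace ℝ (Fin n))
    (hf : ContDiff ℝ 1 f)
    (lam : ℂ) (φ : EuclideanSpace ℝ (Fin n) → ℂ) (hφ : ContDiff ℝ 1 φ)
    (hpde : ∀ x, fderiv ℝ φ x (f x) = lam * φ x)
    (r ε₁ ε₂ : ℝ) (hε₁ : 0 < ε₁)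
    (β : ℝ)
    (hβ : β = sSup ((fun y => ‖fderiv ℝ φ y (nonlinearPart f y)‖) ''
      {y : EuclideanSpace ℝ (Fin n) | ‖y‖ ≤ r - ε₂}))
    (a : ℝ) (ha : 0 ≤ a) (hb : β ≤ ε₁ * (1 + Real.exp (2 * a * ε₂)))
    (x : EuclideanSpace ℝ (Fin n)) (hx : ‖x‖ ≤ r - ε₂) :
    ‖fderiv ℝ φ x (ftilde f a r x) - lam * φ x‖ ≤ ε₁ := by
  have hc : Continuous (fun y => ‖fderiv ℝ φ y (nonlinearPart f y)‖) := by
    have h1 : Continuous (fderiv ℝ φ) := hφ.continuous_fderiv (by norm_num)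
    have h2 : Continuous (nonlinearPart f) := by
      unfold nonlinearPart
      exact hf.continuous.sub (fderiv ℝ f 0).continuous
    exact (h1.clm_apply h2).norm
  have hK : IsCompact {y : EuclideanSpace ℝ (Fin n) | ‖y‖ ≤ r - ε₂} := by
    have := isCompact_closedBall (0 : EuclideanSpace ℝ (Fin n)) (r - ε₂)
    have he : {y : EuclideanSpace ℝ (Fin n) | ‖y‖ ≤ r - ε₂}
        = Metric.closedBall (0 : EuclideanSpace ℝ (Fin n)) (r - ε₂) := by
      ext y
      simp
    rw [he]
    exact this
  have hle : ‖fderiv ℝ φ x (nonlinearPart f x)‖ ≤ β := by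
    rw [hβ]
    exact le_csSup (hK.image hc).bddAbove ⟨x, hx, rfl⟩
  have hE : fderiv ℝ φ x (ftilde f a r x) - lam * φ x
      = -(((1 + Real.tanh (a * (‖x‖ - r))) / 2) • fderiv ℝ φ x (nonlinearPart f x)) := by
    rw [← hpde x]
    unfold ftilde nonlinearPart
    rw [map_add, map_smul, ← smul_neg, ← map_neg, neg_sub, add_sub_cancel_left]
  rw [hE, norm_neg, norm_smul, sig_identity, Real.norm_of_nonneg (by positivity),
    one_div_mul_eq_div, div_le_iff₀ (by positivity)]
  have : Real.exp (2 * a * ε₂) ≤ Real.exp (-(2 * (a * (‖x‖ - r)))) := by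
    apply Real.exp_le_exp.mpr
    nlinarith [mul_nonneg ha (sub_nonneg.mpr hx)]
  nlinarith [mul_le_mul_of_nonneg_left this hε₁.le]

/-- Proposition 1: for any `ε₁ > 0` and `0 < ε₂ < r` there is `a₀ > 0` such that for all
`a ≥ a₀`, `|Dφ(x)[f̃(x)] − λ φ(x)| ≤ ε₁` whenever `‖x‖ ≤ r − ε₂`; in particular, any
`a > (1/ε₂) artanh(1 − 2ε₁/β)` works when `β > 2ε₁`. -/
theorem stmt_9 {n : ℕ}
    (f : EuclideanSpace ℝ (Fin n) → EuclideanSpace ℝ (Fin n))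
    (hf : ContDiff ℝ 1 f) (hf0 : f 0 = 0)
    (lam : ℂ) (φ : EuclideanSpace ℝ (Fin n) → ℂ) (hφ : ContDiff ℝ 1 φ)
    (hpde : ∀ x, fderiv ℝ φ x (f x) = lam * φ x)
    (r ε₁ ε₂ : ℝ) (hr : 0 < r) (hε₁ : 0 < ε₁) (hε₂ : 0 < ε₂) (hε₂r : ε₂ < r)
    (β : ℝ)
    (hβ : β = sSup ((fun y => ‖fderiv ℝ φ y (nonlinearPart f y)‖) ''
      {y : EuclideanSpace ℝ (Fin n) | ‖y‖ ≤ r - ε₂})) :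
    (∃ a₀ > (0 : ℝ), ∀ a ≥ a₀, ∀ x : EuclideanSpace ℝ (Fin n), ‖x‖ ≤ r - ε₂ →
      ‖fderiv ℝ φ x (ftilde f a r x) - lam * φ x‖ ≤ ε₁) ∧
    (2 * ε₁ < β → ∀ a : ℝ, (1 / ε₂) * artanh (1 - 2 * ε₁ / β) < a →
      ∀ x : EuclideanSpace ℝ (Fin n), ‖x‖ ≤ r - ε₂ →
        ‖fderiv ℝ φ x (ftilde f a r x) - lam * φ x‖ ≤ ε₁) := by
  constructor
  · refine ⟨|β| / ε₁ / (2 * ε₂) + 1, by positivity, fun a ha x hx => ?_⟩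
    have ha0 : 0 ≤ a := le_trans (by positivity) ha
    refine core_bound f hf lam φ hφ hpde r ε₁ ε₂ hε₁ β hβ a ha0 ?_ x hx
    have h1 : |β| / ε₁ / (2 * ε₂) ≤ a := by linarith
    rw [div_le_iff₀ (by positivity), div_le_iff₀ hε₁] at h1
    have h2 := Real.add_one_le_exp (2 * a * ε₂)
    nlinarith [mul_le_mul_of_nonneg_left h2 hε₁.le, le_abs_self β]
  · intro hb a ha x hx
    have hβ0 : 0 < β := by linarith
    have hq : (1 + (1 - 2 * ε₁ / β)) / (1 - (1 - 2 * ε₁ / β)) = β / ε₁ - 1 := by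
      have h : 1 - (1 - 2 * ε₁ / β) = 2 * ε₁ / β := by ring
      rw [h]
      field_simp
      ring
    have hgt : 1 < β / ε₁ - 1 := by
      have : 2 < β / ε₁ := by rwa [lt_div_iff₀ hε₁]
      linarith
    unfold artanh at ha
    rw [hq, one_div_mul_eq_div, div_lt_iff₀ hε₂] at ha
    have hl := Real.log_pos hgt
    have ha0 : 0 ≤ a := by
      by_contra hneg
      push Not at hneg
      nlinarith [mul_pos_of_neg_of_neg hneg (neg_lt_zero.mpr hε₂)]
    refine core_bound f hf lam φ hφ hpde r ε₁ ε₂ hε₁ β hβ a ha0 ?_ x hx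
    have h3 : β / ε₁ - 1 ≤ Real.exp (2 * a * ε₂) := by
      rw [← Real.log_le_iff_le_exp (by linarith)]
      linarith
    have h4 : β / ε₁ ≤ 1 + Real.exp (2 * a * ε₂) := by linarith
    rw [div_le_iff₀ hε₁] at h4
    linarith
end

section
/- (Key inequality in Proposition 2.) Let w ∈ ℂⁿ satisfy wᵀ A = λ wᵀ for λ ∈ ℂ, let a, r, ε₂ > 0, and set F := sup_{‖y‖ = r + ε₂} ‖f(y)‖. Then for every x with ‖x‖ = r + ε₂, |wᵀ f̃(x) − λ wᵀ x| ≤ (1/2)(1 − tanh(a ε₂)) · ‖w‖ · ( |λ| (r + ε₂) + F ). -/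
/-- Bilinear (non-conjugated) pairing `wᵀ y` of `w ∈ ℂⁿ` (with its 2-norm) and `y ∈ ℝⁿ`. -/
noncomputable def pairingC {n : ℕ} (w : EuclideanSpace ℂ (Fin n))
    (y : EuclideanSpace ℝ (Fin n)) : ℂ :=
  ∑ i, w i * (y i : ℂ)

theorem pairingC_bound {n : ℕ} (w : EuclideanSpace ℂ (Fin n))
    (y : EuclideanSpace ℝ (Fin n)) : ‖pairingC w y‖ ≤ ‖w‖ * ‖y‖ := by
  unfold pairingC
  refine (norm_sum_le _ _).trans ?_
  have h := Real.sum_mul_le_sqrt_mul_sqrt Finset.univ (fun i => ‖w i‖) (fun i => ‖y i‖)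
  rw [EuclideanSpace.norm_eq, EuclideanSpace.norm_eq]
  simpa [norm_mul] using h

theorem pairingC_comb {n : ℕ} (w : EuclideanSpace ℂ (Fin n))
    (y z : EuclideanSpace ℝ (Fin n)) (s : ℝ) :
    pairingC w (y + s • (z - y)) = pairingC w y + s * (pairingC w z - pairingC w y) := by
  unfold pairingC
  rw [← Finset.sum_sub_distrib, Finset.mul_sum, ← Finset.sum_add_distrib]
  refine Finset.sum_congr rfl fun i _ => ?_
  simp
  ring

/-- Key inequality in Proposition 2: for `‖x‖ = r + ε₂`,
`|wᵀ f̃(x) − λ wᵀ x| ≤ (1/2)(1 − tanh(a ε₂)) ‖w‖ (|λ|(r + ε₂) + F)` with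
`F = sup_{‖y‖ = r + ε₂} ‖f(y)‖`. -/
theorem stmt_10 {n : ℕ}
    (f : EuclideanSpace ℝ (Fin n) → EuclideanSpace ℝ (Fin n))
    (hf : ContDiff ℝ 1 f) (hf0 : f 0 = 0)
    (lam : ℂ) (w : EuclideanSpace ℂ (Fin n))
    (hw : ∀ y, pairingC w (fderiv ℝ f 0 y) = lam * pairingC w y)
    (a r ε₂ : ℝ) (ha : 0 < a) (hr : 0 < r) (hε₂ : 0 < ε₂) :
    ∀ x : EuclideanSpace ℝ (Fin n), ‖x‖ = r + ε₂ →
      ‖pairingC w (ftilde f a r x) - lam * pairingC w x‖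
        ≤ (1 / 2) * (1 - Real.tanh (a * ε₂)) * ‖w‖ *
            (‖lam‖ * (r + ε₂)
              + sSup ((fun y => ‖f y‖) '' {y : EuclideanSpace ℝ (Fin n) | ‖y‖ = r + ε₂})) := by
  intro x hx
  have hF : ‖f x‖ ≤ sSup ((fun y => ‖f y‖) '' {y : EuclideanSpace ℝ (Fin n) | ‖y‖ = r + ε₂}) := by
    refine le_csSup ?_ ⟨x, hx, rfl⟩
    have hc : IsCompact {y : EuclideanSpace ℝ (Fin n) | ‖y‖ = r + ε₂} := by
      have he : {y : EuclideanSpace ℝ (Fin n) | ‖y‖ = r + ε₂} = Metric.sphere 0 (r + ε₂) := by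
        ext y
        simp
      rw [he]
      exact isCompact_sphere _ _
    exact (hc.image hf.continuous.norm).bddAbove
  have ht : Real.tanh (a * ε₂) < 1 := Real.tanh_lt_one _
  have e : pairingC w (ftilde f a r x) - lam * pairingC w x
      = (((1 / 2) * (1 - Real.tanh (a * ε₂)) : ℝ) : ℂ) * (pairingC w (f x) - lam * pairingC w x) := by
    unfold ftilde
    rw [pairingC_comb, hw, hx, add_sub_cancel_left]
    push_cast
    ring
  have h1 := pairingC_bound w (f x)
  have h2 := pairingC_bound w x
  rw [hx] at h2
  rw [e, norm_mul, Complex.norm_real, Real.norm_of_nonneg (by linarith), mul_assoc _ ‖w‖]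
  refine mul_le_mul_of_nonneg_left ?_ (by linarith)
  refine (norm_sub_le _ _).trans ?_
  rw [norm_mul]
  have h3 := mul_le_mul_of_nonneg_left h2 (norm_nonneg lam)
  have h4 := mul_le_mul_of_nonneg_left hF (norm_nonneg w)
  linarith
end

section
/- (Proposition 2: eigenfunction boundary condition.) Let w ∈ ℂⁿ satisfy wᵀ A = λ wᵀ for λ ∈ ℂ, and let r > 0. Then for any positive constants ε₁ and ε₂ there exists a₀ > 0 such that for every a ≥ a₀ the transformed vector field f̃ (built with this a) satisfies |wᵀ f̃(x) − λ wᵀ x| ≤ ε₁ for every x with ‖x‖ = r + ε₂; i.e., the linear function φ̃(x) = wᵀ x approximately satisfies the Koopman generator eigenvalue equation for f̃ on the sphere ‖x‖ = r + ε₂ once a is sufficiently large. -/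
/-- Proposition 2 (eigenfunction boundary condition): for any `ε₁, ε₂ > 0` there is
`a₀ > 0` such that for all `a ≥ a₀`, the linear function `φ̃(x) = wᵀx` approximately
satisfies the Koopman generator equation for `f̃` on the sphere `‖x‖ = r + ε₂`:
`|wᵀ f̃(x) − λ wᵀ x| ≤ ε₁`. -/
theorem stmt_11 {n : ℕ}
    (f : EuclideanSpace ℝ (Fin n) → EuclideanSpace ℝ (Fin n))
    (hf : ContDiff ℝ 1 f) (hf0 : f 0 = 0)
    (lam : ℂ) (w : EuclideanSpace ℂ (Fin n))
    (hw : ∀ y, pairingC w (fderiv ℝ f 0 y) = lam * pairingC w y)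
    (r ε₁ ε₂ : ℝ) (hr : 0 < r) (hε₁ : 0 < ε₁) (hε₂ : 0 < ε₂) :
    ∃ a₀ > (0 : ℝ), ∀ a ≥ a₀, ∀ x : EuclideanSpace ℝ (Fin n), ‖x‖ = r + ε₂ →
      ‖pairingC w (ftilde f a r x) - lam * pairingC w x‖ ≤ ε₁ := by
  have hcont : Continuous (fun x : EuclideanSpace ℝ (Fin n) =>
      pairingC w (f x) - lam * pairingC w x) := by
    have hfc := hf.continuous
    unfold pairingC
    fun_prop
  obtain ⟨C, hC⟩ := (isCompact_sphere (0 : EuclideanSpace ℝ (Fin n)) (r + ε₂)).exists_bound_of_continuousOn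
    hcont.continuousOn
  have hM : 0 < max C 1 := lt_max_of_lt_right one_pos
  refine ⟨max C 1 / (ε₁ * ε₂), by positivity, fun a ha x hx => ?_⟩
  have hCx : ‖pairingC w (f x) - lam * pairingC w x‖ ≤ max C 1 :=
    (hC x (by simpa using hx)).trans (le_max_left _ _)
  have hlin : ∀ (s : ℝ) (u v : EuclideanSpace ℝ (Fin n)),
      pairingC w (u + s • (v - u)) = pairingC w u + s * (pairingC w v - pairingC w u) := by
    intro s u v
    unfold pairingC
    rw [← Finset.sum_sub_distrib, Finset.mul_sum, ← Finset.sum_add_distrib]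
    refine Finset.sum_congr rfl fun i _ => ?_
    simp
    ring
  have hxr : ‖x‖ - r = ε₂ := by rw [hx]; ring
  have hapos : 0 < a := lt_of_lt_of_le (by positivity) ha
  set t := a * ε₂ with ht
  have htpos : 0 < t := by positivity
  have htM : max C 1 ≤ ε₁ * t := by
    have := (div_le_iff₀ (by positivity)).1 ha
    rw [ht]; linarith
  have hkey : (1 - Real.tanh t) / 2 = Real.exp (-t) / (Real.exp t + Real.exp (-t)) := by
    have := Real.exp_pos t
    have := Real.exp_pos (-t)
    rw [Real.tanh_eq]
    field_simp
    ring
  have h0 : 0 ≤ (1 - Real.tanh t) / 2 := by rw [hkey]; positivity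
  have h1 : (1 - Real.tanh t) / 2 ≤ 1 / t := by
    have e1 := Real.add_one_le_exp t
    have e2 := Real.exp_pos (-t)
    have e3 : Real.exp (-t) ≤ 1 := Real.exp_le_one_iff.2 (by linarith)
    rw [hkey]
    exact div_le_div₀ zero_le_one e3 htpos (by linarith)
  have heq : pairingC w (ftilde f a r x) - lam * pairingC w x
      = (((1 - Real.tanh t) / 2 : ℝ) : ℂ) * (pairingC w (f x) - lam * pairingC w x) := by
    unfold ftilde
    rw [hlin, hw, hxr, ← ht]
    push_cast
    ring
  rw [heq, norm_mul, Complex.norm_real, Real.norm_of_nonneg h0]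
  calc _ ≤ 1 / t * max C 1 := by gcongr
    _ ≤ 1 / t * (ε₁ * t) := by gcongr
    _ = ε₁ := by field_simp
end

section
/- (Finite-time path integral with small terminal data, Method B.) Let h : ℝⁿ → ℂ be continuously differentiable and satisfy Dh(y)[f(y)] − λ h(y) + wᵀ f_n(y) = 0 for all y. Fix R > 0 and δ ≥ 0 and suppose |h(y)| ≤ δ for all y with ‖y‖ = R. If x is a point whose trajectory is defined on [0, T] with ‖s_T(x)‖ = R, then |h(x) − ∫₀ᵀ e^{−λτ} wᵀ f_n(s_τ(x)) dτ| ≤ δ · e^{−Re(λ) T}. In particular, if h vanishes identically on the sphere ‖y‖ = R, then h(x) = ∫₀ᵀ e^{−λτ} wᵀ f_n(s_τ(x)) dτ. -/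
/-- Finite-time path integral with small terminal data (Method B): if `|h| ≤ δ` on the
sphere `‖y‖ = R` and the trajectory reaches that sphere at time `T`, then
`|h(x) − ∫₀ᵀ e^{−λτ} wᵀ f_n(s_τ(x)) dτ| ≤ δ e^{−Re(λ)T}`; in particular, if `h` vanishes
on the sphere, `h(x) = ∫₀ᵀ e^{−λτ} wᵀ f_n(s_τ(x)) dτ`. -/
theorem stmt_14 {n : ℕ}
    (f : EuclideanSpace ℝ (Fin n) → EuclideanSpace ℝ (Fin n))
    (hf : ContDiff ℝ 1 f) (hf0 : f 0 = 0)
    (lam : ℂ) (w : Fin n → ℂ)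
    (h : EuclideanSpace ℝ (Fin n) → ℂ) (hh : ContDiff ℝ 1 h)
    (hpde : ∀ y, fderiv ℝ h y (f y) - lam * h y + pairing w (nonlinearPart f y) = 0)
    (R δ : ℝ) (hR : 0 < R) (hδ : 0 ≤ δ)
    (hsmall : ∀ y : EuclideanSpace ℝ (Fin n), ‖y‖ = R → ‖h y‖ ≤ δ)
    (x : EuclideanSpace ℝ (Fin n)) (T : ℝ) (hT : 0 ≤ T)
    (s : ℝ → EuclideanSpace ℝ (Fin n)) (hs0 : s 0 = x)
    (hs : ∀ t ∈ Set.Icc (0 : ℝ) T, HasDerivAt s (f (s t)) t)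
    (hsT : ‖s T‖ = R) :
    ‖h x - ∫ τ in (0 : ℝ)..T, Complex.exp (-lam * τ) * pairing w (nonlinearPart f (s τ))‖
        ≤ δ * Real.exp (-lam.re * T) ∧
    ((∀ y : EuclideanSpace ℝ (Fin n), ‖y‖ = R → h y = 0) →
      h x = ∫ τ in (0 : ℝ)..T, Complex.exp (-lam * τ) * pairing w (nonlinearPart f (s τ))) := by
  have hder : ∀ t ∈ Set.uIcc (0 : ℝ) T,
      HasDerivAt (fun t : ℝ => -(Complex.exp (-lam * t) * h (s t)))
        (Complex.exp (-lam * t) * pairing w (nonlinearPart f (s t))) t := by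
    intro t ht
    rw [Set.uIcc_of_le hT] at ht
    have h1 : HasDerivAt (fun t : ℝ => h (s t)) (fderiv ℝ h (s t) (f (s t))) t :=
      ((hh.differentiable one_ne_zero (s t)).hasFDerivAt).comp_hasDerivAt t (hs t ht)
    have h2 : HasDerivAt (fun t : ℝ => Complex.exp (-lam * t))
        (Complex.exp (-lam * t) * (-lam * 1)) t :=
      ((Complex.ofRealCLM.hasDerivAt (x := t)).const_mul (-lam)).cexp
    refine (h2.mul h1).neg.congr_deriv ?_
    linear_combination (-Complex.exp (-lam * t)) * hpde (s t)
  have hsc : ContinuousOn s (Set.uIcc 0 T) := by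
    rw [Set.uIcc_of_le hT]
    exact fun t ht => (hs t ht).continuousAt.continuousWithinAt
  have hpc : Continuous (fun y => pairing w (nonlinearPart f y)) := by
    have := hf.continuous
    unfold pairing nonlinearPart
    fun_prop
  have hint : IntervalIntegrable
      (fun τ : ℝ => Complex.exp (-lam * τ) * pairing w (nonlinearPart f (s τ)))
      MeasureTheory.volume 0 T := by
    apply ContinuousOn.intervalIntegrable
    exact (Continuous.continuousOn (by fun_prop)).mul (hpc.comp_continuousOn hsc)
  have key := intervalIntegral.integral_eq_sub_of_hasDerivAt hder hint
  have hkey : h x - ∫ τ in (0 : ℝ)..T, Complex.exp (-lam * τ) * pairing w (nonlinearPart f (s τ))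
      = Complex.exp (-lam * T) * h (s T) := by
    rw [key, hs0]
    simp
  refine ⟨?_, fun h0 => ?_⟩
  · rw [hkey, norm_mul, Complex.norm_exp, mul_comm]
    have : (-lam * (T : ℂ)).re = -lam.re * T := by simp
    rw [this]
    exact mul_le_mul_of_nonneg_right (hsmall _ hsT) (Real.exp_pos _).le
  · rw [h0 _ hsT, mul_zero] at hkey
    exact sub_eq_zero.mp hkey
end
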